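/- arXiv:1201.4651 — 8 statements merged into one kernel-verified Lean document; each statement's English description precedes it below -/
import Mathlib

section
/- Let $n, r$ be positive integers with $2r \le n$, let $U$ be a real $n \times 2r$ matrix of rank $2r$, and let $J_{2r}$ be the $2r \times 2r$ symplectic identity matrix $J_{2r} = \begin{pmatrix} 0 & I_r \\ -I_r & 0 \end{pmatrix}$. Set $A = U U^T$ and $B = U J_{2r} U^T$, and let $Z$ be the $2n \times 2n$ block matrix $Z = \begin{pmatrix} A & B \\ B^T & A \end{pmatrix}$. Then $\mathrm{rank}(Z) = \mathrm{rank}(A) = 2r$. -/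
open Matrix

/-- Stacking rows below a matrix of full column rank does not change the rank. -/
theorem Matrix.rank_fromRows_of_rank_eq_card {l m n R : Type*} [Fintype l] [Fintype m] [Fintype n]
    [CommSemiring R] [StrongRankCondition R] [DecidableEq m]
    (U : Matrix m n R) (hU : U.rank = Fintype.card n) (V : Matrix l n R) :
    (Matrix.fromRows U V).rank = U.rank := by
  refine le_antisymm (hU ▸ rank_le_card_width _) ?_
  have h : U = fromCols (1 : Matrix m m R) (0 : Matrix m l R) * fromRows U V := by
    simp [fromCols_mul_fromRows]
  calc U.rank = (fromCols (1 : Matrix m m R) (0 : Matrix m l R) * fromRows U V).rank := by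
        rw [← h]
    _ ≤ (fromRows U V).rank := rank_mul_le_right _ _

theorem rank_of_block_symplectic
    (n r : ℕ) (hr : 0 < r) (hn : 2 * r ≤ n)
    (U : Matrix (Fin n) (Fin r ⊕ Fin r) ℝ) (hU : U.rank = 2 * r)
    (J : Matrix (Fin r ⊕ Fin r) (Fin r ⊕ Fin r) ℝ)
    (hJ : J = Matrix.fromBlocks 0 1 (-1) 0)
    (A : Matrix (Fin n) (Fin n) ℝ) (hA : A = U * Uᵀ)
    (B : Matrix (Fin n) (Fin n) ℝ) (hB : B = U * J * Uᵀ)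
    (Z : Matrix (Fin n ⊕ Fin n) (Fin n ⊕ Fin n) ℝ)
    (hZ : Z = Matrix.fromBlocks A B Bᵀ A) :
    Z.rank = A.rank ∧ A.rank = 2 * r := by
  have hJJ : Jᵀ * J = 1 := by
    simp [hJ, fromBlocks_transpose, fromBlocks_multiply]
  have hZW : Z = fromRows U (U * Jᵀ) * (fromRows U (U * Jᵀ))ᵀ := by
    have hUJ : U * Jᵀ * (J * Uᵀ) = U * Uᵀ := by
      rw [Matrix.mul_assoc, ← Matrix.mul_assoc Jᵀ, hJJ, Matrix.one_mul]
    simp only [hZ, hA, hB, transpose_fromRows, fromRows_mul_fromCols, transpose_mul,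
      transpose_transpose, hUJ, Matrix.mul_assoc]
  have hAU : A.rank = U.rank := by rw [hA, rank_self_mul_transpose]
  refine ⟨?_, hAU.trans hU⟩
  rw [hAU, hZW, rank_self_mul_transpose]
  exact rank_fromRows_of_rank_eq_card U (by simp [hU, two_mul]) _
end

section
/- Let $n \ge 2$ and $x \in \mathbb{R}^n$, and let $\hat{P}$ be the $2n \times 2n$ block matrix $\hat{P} = \begin{pmatrix} \hat{A} & \hat{B} \\ \hat{B}^T & \hat{A} \end{pmatrix}$, where $\hat{a}_{ij} = \cos(x_i - x_j)$ and $\hat{b}_{ij} = \sin(x_i - x_j)$. If there exist indices $i, j$ with $\sin(x_i - x_j) \ne 0$, then $\mathrm{rank}(\hat{P}) = 2$. -/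
open Matrix

/-- The rows of this matrix are the points of the unit circle at the angles `x i`, followed by the
same points rotated by a quarter turn. -/
noncomputable def circleRows {ι : Type*} (x : ι → ℝ) : Matrix (ι ⊕ ι) (Fin 2) ℝ :=
  fromRows (of fun i => ![Real.cos (x i), Real.sin (x i)])
    (of fun i => ![-Real.sin (x i), Real.cos (x i)])

theorem circleRows_mul_transpose {ι : Type*} (x : ι → ℝ) :
    circleRows x * (circleRows x)ᵀ =
      fromBlocks (of fun i j => Real.cos (x i - x j)) (of fun i j => Real.sin (x i - x j))
        (of fun i j => Real.sin (x i - x j))ᵀ (of fun i j => Real.cos (x i - x j)) := by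
  ext (i | i) (j | j) <;>
    simp [circleRows, mul_apply, Fin.sum_univ_two, Real.cos_sub, Real.sin_sub] <;> ring

theorem transpose_circleRows_mul {ι : Type*} [Fintype ι] (x : ι → ℝ) :
    (circleRows x)ᵀ * circleRows x = diagonal fun _ => (Fintype.card ι : ℝ) := by
  ext a b
  fin_cases a <;> fin_cases b <;>
    simp [circleRows, mul_apply, ← Finset.sum_add_distrib, ← sq, mul_comm]

theorem rank_circleRows {ι : Type*} [Fintype ι] [Nonempty ι] (x : ι → ℝ) :
    (circleRows x).rank = 2 := by
  rw [← rank_transpose_mul_self, transpose_circleRows_mul, rank_of_det_ne_zero, Fintype.card_fin]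
  simp [det_diagonal]

theorem rank_pure_trig_eq_two
    (n : ℕ) (hn : 2 ≤ n) (x : Fin n → ℝ)
    (Ahat Bhat : Matrix (Fin n) (Fin n) ℝ)
    (hA : Ahat = Matrix.of fun i j => Real.cos (x i - x j))
    (hB : Bhat = Matrix.of fun i j => Real.sin (x i - x j))
    (Phat : Matrix (Fin n ⊕ Fin n) (Fin n ⊕ Fin n) ℝ)
    (hP : Phat = Matrix.fromBlocks Ahat Bhat Bhatᵀ Ahat)
    (hex : ∃ i j, Real.sin (x i - x j) ≠ 0) :
    Phat.rank = 2 := by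
  obtain ⟨i, -⟩ := hex
  have : Nonempty (Fin n) := ⟨i⟩
  rw [hP, hA, hB, ← circleRows_mul_transpose, rank_self_mul_transpose, rank_circleRows]
end

section
/- Let $n \ge 1$, let $x, l, h \in \mathbb{R}^n$, let $L = l h^T + h l^T$, and let $P$ be the $2n \times 2n$ block matrix $\begin{pmatrix} A & B \\ B^T & A \end{pmatrix}$ with $a_{ij} = L_{ij}\cos(x_i - x_j)$ and $b_{ij} = L_{ij}\sin(x_i - x_j)$. Then $\mathrm{rank}(P) \le 4$. -/
open Matrix

theorem rank_gen_trig_le_four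
    (n : ℕ) (hn : 1 ≤ n) (x l h : Fin n → ℝ)
    (L : Matrix (Fin n) (Fin n) ℝ)
    (hL : L = Matrix.of fun i j => l i * h j + h i * l j)
    (A B : Matrix (Fin n) (Fin n) ℝ)
    (hA : A = Matrix.of fun i j => L i j * Real.cos (x i - x j))
    (hB : B = Matrix.of fun i j => L i j * Real.sin (x i - x j))
    (P : Matrix (Fin n ⊕ Fin n) (Fin n ⊕ Fin n) ℝ)
    (hP : P = Matrix.fromBlocks A B Bᵀ A) :
    P.rank ≤ 4 := by
  let u : Fin n ⊕ Fin n → ℝ := Sum.elim (fun i => Real.cos (x i)) (fun i => -Real.sin (x i))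
  let v : Fin n ⊕ Fin n → ℝ := Sum.elim (fun i => Real.sin (x i)) (fun i => Real.cos (x i))
  let l' : Fin n ⊕ Fin n → ℝ := Sum.elim l l
  let h' : Fin n ⊕ Fin n → ℝ := Sum.elim h h
  let U : Matrix (Fin n ⊕ Fin n) (Fin 4) ℝ :=
    Matrix.of fun p => ![l' p * u p, h' p * u p, l' p * v p, h' p * v p]
  let V : Matrix (Fin 4) (Fin n ⊕ Fin n) ℝ :=
    Matrix.of ![fun q => h' q * u q, fun q => l' q * u q, fun q => h' q * v q, fun q => l' q * v q]
  have hUV : P = U * V := by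
    subst hP hA hB hL
    ext (i | i) (j | j) <;>
      simp [U, V, u, v, l', h', Matrix.mul_apply, Fin.sum_univ_four, Real.cos_sub, Real.sin_sub] <;>
      ring
  calc P.rank = (U * V).rank := by rw [hUV]
    _ ≤ U.rank := Matrix.rank_mul_le_left U V
    _ ≤ 4 := by simpa using U.rank_le_card_width
end

section
/- Let $n \ge 1$, let $x, l, h \in \mathbb{R}^n$, let $L = l h^T + h l^T$, and let $P$ be the $2n \times 2n$ block matrix $\begin{pmatrix} A & B \\ B^T & A \end{pmatrix}$ with $a_{ij} = L_{ij}\cos(x_i - x_j)$ and $b_{ij} = L_{ij}\sin(x_i - x_j)$. Then $\mathrm{trace}(P^2) = 2\,\mathrm{trace}(L^2)$. -/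
open Matrix

theorem trace_fromBlocks_eq_add {m n R : Type*} [Fintype m] [Fintype n] [AddCommMonoid R]
    (A : Matrix m m R) (B : Matrix m n R) (C : Matrix n m R) (D : Matrix n n R) :
    (Matrix.fromBlocks A B C D).trace = A.trace + D.trace := by
  simp [Matrix.trace, Fintype.sum_sum_type]

theorem trace_sq_gen_trig
    (n : ℕ) (hn : 1 ≤ n) (x l h : Fin n → ℝ)
    (L : Matrix (Fin n) (Fin n) ℝ)
    (hL : L = Matrix.of fun i j => l i * h j + h i * l j)
    (A B : Matrix (Fin n) (Fin n) ℝ)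
    (hA : A = Matrix.of fun i j => L i j * Real.cos (x i - x j))
    (hB : B = Matrix.of fun i j => L i j * Real.sin (x i - x j))
    (P : Matrix (Fin n ⊕ Fin n) (Fin n ⊕ Fin n) ℝ)
    (hP : P = Matrix.fromBlocks A B Bᵀ A) :
    (P ^ 2).trace = 2 * (L ^ 2).trace := by
  have hsymm : ∀ i j, L j i = L i j := fun i j => by
    simp only [hL, Matrix.of_apply]
    ring
  have key : (A * A).trace + (B * Bᵀ).trace = (L * L).trace := by
    simp only [Matrix.trace, Matrix.diag_apply, Matrix.mul_apply, ← Finset.sum_add_distrib]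
    refine Finset.sum_congr rfl fun i _ => Finset.sum_congr rfl fun j _ => ?_
    simp only [hA, hB, Matrix.of_apply, Matrix.transpose_apply, hsymm i j]
    rw [← neg_sub (x i) (x j), Real.cos_neg]
    linear_combination (L i j * L i j) * Real.cos_sq_add_sin_sq (x i - x j)
  rw [hP, pow_two, pow_two, Matrix.fromBlocks_multiply, trace_fromBlocks_eq_add,
    Matrix.trace_add, Matrix.trace_add, Matrix.trace_mul_comm Bᵀ B]
  linarith
end

section
/- Let $n \ge 1$, let $x, l, h \in \mathbb{R}^n$, let $L = l h^T + h l^T$, and let $P$ be the $2n \times 2n$ block matrix $\begin{pmatrix} A & B \\ B^T & A \end{pmatrix}$ with $a_{ij} = L_{ij}\cos(x_i - x_j)$ and $b_{ij} = L_{ij}\sin(x_i - x_j)$. Then $\mathrm{trace}(P^3) = 2\,\mathrm{trace}(L^3)$. -/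
open Matrix

/-- The orthogonal block matrix rotating the `i`-th coordinate plane by the angle `x i`. -/
noncomputable def blockRotation {ι : Type*} [DecidableEq ι] (x : ι → ℝ) :
    Matrix (ι ⊕ ι) (ι ⊕ ι) ℝ :=
  fromBlocks (diagonal fun i => Real.cos (x i)) (diagonal fun i => Real.sin (x i))
    (-diagonal fun i => Real.sin (x i)) (diagonal fun i => Real.cos (x i))

theorem blockRotation_transpose_mul_self {ι : Type*} [Fintype ι] [DecidableEq ι] (x : ι → ℝ) :
    (blockRotation x)ᵀ * blockRotation x = 1 := by
  simp only [blockRotation, fromBlocks_transpose, fromBlocks_multiply, ← fromBlocks_one,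
    transpose_neg, diagonal_transpose, neg_mul, mul_neg, neg_neg, diagonal_mul_diagonal,
    diagonal_add]
  congr 1 <;> ext i j <;> obtain rfl | hij := eq_or_ne i j <;>
    simp [*, ← sq, mul_comm]

theorem blockRotation_conj {ι : Type*} [Fintype ι] [DecidableEq ι] (x : ι → ℝ)
    {L : Matrix ι ι ℝ} (hL : L.IsSymm) :
    blockRotation x * fromBlocks L 0 0 L * (blockRotation x)ᵀ =
      fromBlocks (of fun i j => L i j * Real.cos (x i - x j))
        (of fun i j => L i j * Real.sin (x i - x j))
        (of fun i j => L i j * Real.sin (x i - x j))ᵀ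
        (of fun i j => L i j * Real.cos (x i - x j)) := by
  simp only [blockRotation, fromBlocks_transpose, fromBlocks_multiply]
  congr 1 <;> ext i j <;>
    simp [mul_diagonal, diagonal_mul, Real.cos_sub, Real.sin_sub, hL.apply i j] <;> ring

theorem trace_cube_gen_trig
    (n : ℕ) (hn : 1 ≤ n) (x l h : Fin n → ℝ)
    (L : Matrix (Fin n) (Fin n) ℝ)
    (hL : L = Matrix.of fun i j => l i * h j + h i * l j)
    (A B : Matrix (Fin n) (Fin n) ℝ)
    (hA : A = Matrix.of fun i j => L i j * Real.cos (x i - x j))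
    (hB : B = Matrix.of fun i j => L i j * Real.sin (x i - x j))
    (P : Matrix (Fin n ⊕ Fin n) (Fin n ⊕ Fin n) ℝ)
    (hP : P = Matrix.fromBlocks A B Bᵀ A) :
    (P ^ 3).trace = 2 * (L ^ 3).trace := by
  have hsymm : L.IsSymm := by
    ext i j
    simp only [hL, transpose_apply, of_apply]
    ring
  have hU := blockRotation_transpose_mul_self x
  rw [hP, hA, hB, ← blockRotation_conj x hsymm]
  set U := blockRotation x
  set M := fromBlocks L 0 0 L with hM
  have hcube : (U * M * Uᵀ) ^ 3 = U * M ^ 3 * Uᵀ := by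
    calc (U * M * Uᵀ) ^ 3 = U * M * (Uᵀ * U) * M * (Uᵀ * U) * M * Uᵀ := by
          simp only [pow_succ, pow_zero, one_mul, Matrix.mul_assoc]
      _ = U * M ^ 3 * Uᵀ := by
          simp only [hU, pow_succ, pow_zero, one_mul, mul_one, Matrix.mul_assoc]
  rw [hcube, trace_mul_comm, ← Matrix.mul_assoc, hU, one_mul, hM, fromBlocks_diagonal_pow,
    two_mul]
  simp [trace, Fintype.sum_sum_type]
end

section
/- Let $n \ge 2$, let $x, l, h \in \mathbb{R}^n$, let $L = l h^T + h l^T$, and let $P$ be the $2n \times 2n$ block matrix $\begin{pmatrix} A & B \\ B^T & A \end{pmatrix}$ with $a_{ij} = L_{ij}\cos(x_i - x_j)$ and $b_{ij} = L_{ij}\sin(x_i - x_j)$. Set $\gamma = l^T h$ and $\delta = \|l\| \cdot \|h\|$ (Euclidean norms). Then the characteristic polynomial of $P$ equals $X^{2n-4}\,\bigl(X - (\gamma + \delta)\bigr)^2 \bigl(X - (\gamma - \delta)\bigr)^2$. -/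
open Matrix Polynomial

/-- The `n × 2` factor, twisted by the angles, in the rank-four factorization of the generalized
trigonometric matrix. -/
noncomputable def genTrigLeft {n : ℕ} (x l h : Fin n → ℝ) : Matrix (Fin n ⊕ Fin n) (Fin 2 ⊕ Fin 2) ℝ :=
  Matrix.fromBlocks
    (Matrix.of fun i => ![l i * Real.cos (x i), h i * Real.cos (x i)])
    (Matrix.of fun i => ![l i * Real.sin (x i), h i * Real.sin (x i)])
    (Matrix.of fun i => ![-(l i * Real.sin (x i)), -(h i * Real.sin (x i))])
    (Matrix.of fun i => ![l i * Real.cos (x i), h i * Real.cos (x i)])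

theorem genTrigLeft_mul_transpose {n : ℕ} (x l h : Fin n → ℝ) :
    genTrigLeft x l h * (genTrigLeft x h l)ᵀ = Matrix.fromBlocks
      (Matrix.of fun i j => (l i * h j + h i * l j) * Real.cos (x i - x j))
      (Matrix.of fun i j => (l i * h j + h i * l j) * Real.sin (x i - x j))
      (Matrix.of fun i j => (l i * h j + h i * l j) * Real.sin (x i - x j))ᵀ
      (Matrix.of fun i j => (l i * h j + h i * l j) * Real.cos (x i - x j)) := by
  ext (i | i) (j | j) <;>
    simp [genTrigLeft, Matrix.mul_apply, Real.cos_sub, Real.sin_sub] <;> ring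

theorem transpose_mul_genTrigLeft {n : ℕ} (x l h : Fin n → ℝ) :
    (genTrigLeft x h l)ᵀ * genTrigLeft x l h = Matrix.fromBlocks
      !![∑ i, l i * h i, ∑ i, h i ^ 2; ∑ i, l i ^ 2, ∑ i, l i * h i] 0 0
      !![∑ i, l i * h i, ∑ i, h i ^ 2; ∑ i, l i ^ 2, ∑ i, l i * h i] := by
  ext (i | i) (j | j) <;> fin_cases i <;> fin_cases j <;>
    simp [genTrigLeft, Matrix.mul_apply, ← Finset.sum_add_distrib] <;>
    first
    | (refine Finset.sum_congr rfl fun k _ => ?_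
       linear_combination (l k * h k) * Real.sin_sq_add_cos_sq (x k))
    | (refine Finset.sum_congr rfl fun k _ => ?_
       linear_combination (h k ^ 2) * Real.sin_sq_add_cos_sq (x k))
    | (refine Finset.sum_congr rfl fun k _ => ?_
       linear_combination (l k ^ 2) * Real.sin_sq_add_cos_sq (x k))
    | (rw [← sub_eq_add_neg, sub_eq_zero]
       exact Finset.sum_congr rfl fun k _ => by ring)

theorem charpoly_gen_trig
    (n : ℕ) (hn : 2 ≤ n) (x l h : Fin n → ℝ)
    (L : Matrix (Fin n) (Fin n) ℝ)
    (hL : L = Matrix.of fun i j => l i * h j + h i * l j)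
    (A B : Matrix (Fin n) (Fin n) ℝ)
    (hA : A = Matrix.of fun i j => L i j * Real.cos (x i - x j))
    (hB : B = Matrix.of fun i j => L i j * Real.sin (x i - x j))
    (P : Matrix (Fin n ⊕ Fin n) (Fin n ⊕ Fin n) ℝ)
    (hP : P = Matrix.fromBlocks A B Bᵀ A)
    (γ δ : ℝ) (hγ : γ = ∑ i, l i * h i)
    (hδ : δ = Real.sqrt (∑ i, (l i) ^ 2) * Real.sqrt (∑ i, (h i) ^ 2)) :
    P.charpoly = X ^ (2 * n - 4) * (X - C (γ + δ)) ^ 2 * (X - C (γ - δ)) ^ 2 := by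
  have hP' : P = genTrigLeft x l h * (genTrigLeft x h l)ᵀ := by
    subst hL hA hB hP
    exact (genTrigLeft_mul_transpose x l h).symm
  have hδ2 : (∑ i, h i ^ 2) * ∑ i, l i ^ 2 = δ ^ 2 := by
    rw [hδ, mul_pow, Real.sq_sqrt (Finset.sum_nonneg fun i _ => sq_nonneg (l i)),
      Real.sq_sqrt (Finset.sum_nonneg fun i _ => sq_nonneg (h i)), mul_comm]
  have hcard : Fintype.card (Fin 2 ⊕ Fin 2) ≤ Fintype.card (Fin n ⊕ Fin n) := by
    simp only [Fintype.card_sum, Fintype.card_fin]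
    omega
  have hexp : Fintype.card (Fin n ⊕ Fin n) - Fintype.card (Fin 2 ⊕ Fin 2) = 2 * n - 4 := by
    simp only [Fintype.card_sum, Fintype.card_fin]
    omega
  rw [hP', Matrix.charpoly_mul_comm_of_le _ _ hcard, hexp, transpose_mul_genTrigLeft,
    Matrix.charpoly_fromBlocks_zero₁₂, Matrix.charpoly_fin_two, ← hγ, Matrix.trace_fin_two_of,
    Matrix.det_fin_two_of, hδ2]
  simp only [map_add, map_sub, map_mul, map_pow]
  ring
end

section
/- Let $n \ge 2$, let $x, l, h \in \mathbb{R}^n$ with $l$ and $h$ linearly independent, let $L = l h^T + h l^T$, and let $P$ be the $2n \times 2n$ block matrix $\begin{pmatrix} A & B \\ B^T & A \end{pmatrix}$ with $a_{ij} = L_{ij}\cos(x_i - x_j)$ and $b_{ij} = L_{ij}\sin(x_i - x_j)$. Set $\gamma = l^T h$ and $\delta = \|l\| \cdot \|h\|$. Then the real numbers $\gamma + \delta$ and $\gamma - \delta$ are both nonzero, $\gamma + \delta$ is a positive eigenvalue of $P$ of algebraic multiplicity $2$, $\gamma - \delta$ is a negative eigenvalue of $P$ of algebraic multiplicity $2$,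 and $0$ is an eigenvalue of algebraic multiplicity $2n - 4$; $P$ has no other eigenvalues. -/
open Matrix Polynomial

/-- Strict Cauchy-Schwarz inequality for linearly independent real vectors. -/
lemma sq_dotProduct_lt_of_linearIndependent {ι : Type*} [Fintype ι] {l h : ι → ℝ}
    (hli : LinearIndependent ℝ ![l, h]) :
    (∑ i, l i * h i) ^ 2 < (∑ i, l i ^ 2) * ∑ i, h i ^ 2 := by
  rw [LinearIndependent.pair_iff] at hli
  set γ := ∑ i, l i * h i with hγ
  set q := ∑ i, h i ^ 2 with hq
  have pos_of_ne : ∀ {v : ι → ℝ}, v ≠ 0 → 0 < ∑ i, v i ^ 2 := fun {v} hv => by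
    obtain ⟨i, hi⟩ := Function.ne_iff.mp hv
    exact Finset.sum_pos' (fun i _ => sq_nonneg (v i)) ⟨i, Finset.mem_univ i, sq_pos_of_ne_zero hi⟩
  have hq0 : 0 < q := pos_of_ne fun h0 => one_ne_zero (hli 0 1 (by simp [h0])).2
  have hw : 0 < ∑ i, (q • l + (-γ) • h) i ^ 2 :=
    pos_of_ne fun h0 => hq0.ne' (hli q (-γ) h0).1
  have expand : ∑ i, (q • l + (-γ) • h) i ^ 2 = q * ((∑ i, l i ^ 2) * q - γ ^ 2) := by
    calc ∑ i, (q • l + (-γ) • h) i ^ 2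
        = ∑ i, (q ^ 2 * l i ^ 2 - 2 * q * γ * (l i * h i) + γ ^ 2 * h i ^ 2) :=
          Finset.sum_congr rfl fun i _ => by
            simp only [Pi.add_apply, Pi.smul_apply, smul_eq_mul]; ring
      _ = q ^ 2 * (∑ i, l i ^ 2) - 2 * q * γ * γ + γ ^ 2 * q := by
          rw [Finset.sum_add_distrib, Finset.sum_sub_distrib, ← Finset.mul_sum,
            ← Finset.mul_sum, ← Finset.mul_sum]
      _ = _ := by ring
  rw [expand] at hw
  linarith [pos_of_mul_pos_right hw hq0.le]

/-- The matrix with columns the products of `l` and `h` with `(cos x, -sin x)` and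
`(sin x, cos x)`. -/
noncomputable def trigFactor {ι : Type*} (x l h : ι → ℝ) :
    Matrix (ι ⊕ ι) (Fin 2 ⊕ Fin 2) ℝ :=
  fromBlocks
    (of fun i k => ![l i, h i] k * Real.cos (x i)) (of fun i k => ![l i, h i] k * Real.sin (x i))
    (of fun i k => -(![l i, h i] k * Real.sin (x i)))
    (of fun i k => ![l i, h i] k * Real.cos (x i))

lemma trigFactor_mul_transpose {ι : Type*} (x l h : ι → ℝ) :
    trigFactor x l h * (trigFactor x h l)ᵀ =
      fromBlocks (of fun i j => (l i * h j + h i * l j) * Real.cos (x i - x j))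
        (of fun i j => (l i * h j + h i * l j) * Real.sin (x i - x j))
        (of fun i j => (l i * h j + h i * l j) * Real.sin (x i - x j))ᵀ
        (of fun i j => (l i * h j + h i * l j) * Real.cos (x i - x j)) := by
  rw [trigFactor, trigFactor, fromBlocks_transpose, fromBlocks_multiply, fromBlocks_inj]
  refine ⟨?_, ?_, ?_, ?_⟩ <;> ext i j <;>
    simp [mul_apply, Fin.sum_univ_two, Real.cos_sub, Real.sin_sub] <;> ring

lemma transpose_mul_trigFactor {ι : Type*} [Fintype ι] (x l h : ι → ℝ) :
    (trigFactor x h l)ᵀ * trigFactor x l h =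
      fromBlocks !![∑ i, l i * h i, ∑ i, h i ^ 2; ∑ i, l i ^ 2, ∑ i, l i * h i] 0 0
        !![∑ i, l i * h i, ∑ i, h i ^ 2; ∑ i, l i ^ 2, ∑ i, l i * h i] := by
  rw [trigFactor, trigFactor, fromBlocks_transpose, fromBlocks_multiply, fromBlocks_inj]
  refine ⟨?_, ?_, ?_, ?_⟩ <;> ext i j <;>
    simp only [Matrix.add_apply, mul_apply, Matrix.zero_apply, ← Finset.sum_add_distrib]
  rotate_left
  · exact Finset.sum_eq_zero fun k _ => by simp only [transpose_apply, of_apply]; ring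
  · exact Finset.sum_eq_zero fun k _ => by simp only [transpose_apply, of_apply]; ring
  all_goals
    fin_cases i <;> fin_cases j <;> simp <;> refine Finset.sum_congr rfl fun k _ => ?_ <;>
      have := Real.sin_sq_add_cos_sq (x k) <;> grind

theorem eigenvalues_gen_trig
    (n : ℕ) (hn : 2 ≤ n) (x l h : Fin n → ℝ)
    (hli : LinearIndependent ℝ ![l, h])
    (L : Matrix (Fin n) (Fin n) ℝ)
    (hL : L = Matrix.of fun i j => l i * h j + h i * l j)
    (A B : Matrix (Fin n) (Fin n) ℝ)
    (hA : A = Matrix.of fun i j => L i j * Real.cos (x i - x j))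
    (hB : B = Matrix.of fun i j => L i j * Real.sin (x i - x j))
    (P : Matrix (Fin n ⊕ Fin n) (Fin n ⊕ Fin n) ℝ)
    (hP : P = Matrix.fromBlocks A B Bᵀ A)
    (γ δ : ℝ) (hγ : γ = ∑ i, l i * h i)
    (hδ : δ = Real.sqrt (∑ i, (l i) ^ 2) * Real.sqrt (∑ i, (h i) ^ 2)) :
    γ + δ ≠ 0 ∧ γ - δ ≠ 0 ∧ 0 < γ + δ ∧ γ - δ < 0 ∧
    P.charpoly.rootMultiplicity (γ + δ) = 2 ∧
    P.charpoly.rootMultiplicity (γ - δ) = 2 ∧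
    P.charpoly.rootMultiplicity 0 = 2 * n - 4 ∧
    (∀ μ : ℝ, P.charpoly.IsRoot μ → μ = γ + δ ∨ μ = γ - δ ∨ μ = 0) := by
  have hδ0 : 0 ≤ δ := by rw [hδ]; positivity
  have hδsq : δ ^ 2 = (∑ i, l i ^ 2) * ∑ i, h i ^ 2 := by
    rw [hδ, mul_pow, Real.sq_sqrt (by positivity), Real.sq_sqrt (by positivity)]
  have hlt : |γ| < δ := abs_lt_of_sq_lt_sq
    (by rw [hδsq, hγ]; exact sq_dotProduct_lt_of_linearIndependent hli) hδ0
  obtain ⟨hneg, hpos⟩ := abs_lt.mp hlt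
  have hplus : 0 < γ + δ := by linarith
  have hminus : γ - δ < 0 := by linarith
  have hPfactor : P = trigFactor x l h * (trigFactor x h l)ᵀ := by
    rw [trigFactor_mul_transpose, hP, hA, hB, hL]
    rfl
  have hchar : P.charpoly =
      (X - C 0) ^ (2 * n - 4) * ((X - C (γ + δ)) ^ 2 * (X - C (γ - δ)) ^ 2) := by
    have hcomm := charpoly_mul_comm' (trigFactor x l h) (trigFactor x h l)ᵀ
    rw [← hPfactor, transpose_mul_trigFactor, charpoly_fromBlocks_zero₁₂, charpoly_fin_two,
      trace_fin_two_of, det_fin_two_of, ← hγ,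
      mul_comm (∑ i, h i ^ 2), ← hδsq] at hcomm
    simp only [Fintype.card_sum, Fintype.card_fin] at hcomm
    refine mul_left_cancel₀ (pow_ne_zero (2 + 2) (X_ne_zero (R := ℝ))) (hcomm.trans ?_)
    rw [show n + n = (2 + 2) + (2 * n - 4) by lia, pow_add]
    simp only [map_add, map_sub, map_mul, map_pow, map_zero]
    ring
  have hne : P.charpoly ≠ 0 := P.charpoly_monic.ne_zero
  have hmult (μ : ℝ) : P.charpoly.rootMultiplicity μ =
      (if μ = 0 then 2 * n - 4 else 0) +
        ((if μ = γ + δ then 2 else 0) + if μ = γ - δ then 2 else 0) := by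
    classical
    rw [← count_roots, hchar, roots_mul (hchar ▸ hne),
      roots_mul (right_ne_zero_of_mul (hchar ▸ hne)), roots_pow, roots_pow, roots_pow,
      roots_X_sub_C, roots_X_sub_C, roots_X_sub_C]
    simp [Multiset.count_singleton]
  refine ⟨hplus.ne', hminus.ne, hplus, hminus, ?_, ?_, ?_, fun μ hμ => ?_⟩
  · rw [hmult, if_neg hplus.ne', if_pos rfl, if_neg (by linarith)]
  · rw [hmult, if_neg hminus.ne, if_neg (by linarith), if_pos rfl]
  · rw [hmult, if_pos rfl, if_neg hplus.ne, if_neg hminus.ne', add_zero, add_zero]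
  · by_contra! hcon
    have := (rootMultiplicity_pos hne).mpr hμ
    rw [hmult, if_neg hcon.2.2, if_neg hcon.1, if_neg hcon.2.1] at this
    exact this.false
end

section
/- Let $n \ge 2$, let $x, l, h \in \mathbb{R}^n$, let $L = l h^T + h l^T$, and let $P$ be the $2n \times 2n$ block matrix $\begin{pmatrix} A & B \\ B^T & A \end{pmatrix}$ with $a_{ij} = L_{ij}\cos(x_i - x_j)$ and $b_{ij} = L_{ij}\sin(x_i - x_j)$. Set $\gamma = l^T h$ and $\delta = \|l\| \cdot \|h\|$. If $\mathrm{rank}(L) = 1$, then $\delta = |\gamma| \ne 0$ and the characteristic polynomial of $P$ equals $X^{2n-2}(X - 2\gamma)^2$ if $\gamma = \delta$, and $X^{2n-2}(X+2\delta)^2$ if $\gamma = -\delta$; in particular $P$ has exactly two nonzero eigenvalues counted with multiplicity. -/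
open Matrix Polynomial

/-- All `2 × 2` minors of a matrix of rank at most one vanish. -/
theorem Matrix.mul_apply_eq_of_rank_le_one {m n K : Type*} [Fintype n] [Finite m] [Field K]
    (M : Matrix m n K) (hM : M.rank ≤ 1) (i k : m) (j p : n) :
    M i j * M k p = M i p * M k j := by
  classical
  obtain ⟨v, hv⟩ := finrank_le_one_iff.mp hM
  obtain ⟨a, ha⟩ := hv ⟨M.mulVecLin (Pi.single j 1), LinearMap.mem_range_self _ _⟩
  obtain ⟨b, hb⟩ := hv ⟨M.mulVecLin (Pi.single p 1), LinearMap.mem_range_self _ _⟩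
  have hj (r : m) : a * (v : m → K) r = M r j := by
    simpa using congrFun (congrArg Subtype.val ha) r
  have hp (r : m) : b * (v : m → K) r = M r p := by
    simpa using congrFun (congrArg Subtype.val hb) r
  rw [← hj, ← hj, ← hp, ← hp]
  ring

theorem Matrix.charpoly_fromBlocks_mul_cos_sin {ι : Type*} [Fintype ι] [DecidableEq ι] [Nonempty ι]
    (c : ℝ) (x l : ι → ℝ) :
    (fromBlocks (of fun i j => c * l i * l j * Real.cos (x i - x j))
      (of fun i j => c * l i * l j * Real.sin (x i - x j))
      (of fun i j => c * l i * l j * Real.sin (x i - x j))ᵀ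
      (of fun i j => c * l i * l j * Real.cos (x i - x j))).charpoly =
    X ^ (2 * Fintype.card ι - 2) * (X - C (c * ∑ i, l i ^ 2)) ^ 2 := by
  let W : Matrix (ι ⊕ ι) (Fin 2) ℝ := of fun i => Sum.elim
    (fun i => ![l i * Real.cos (x i), l i * Real.sin (x i)])
    (fun i => ![-(l i * Real.sin (x i)), l i * Real.cos (x i)]) i
  have hfac : fromBlocks (of fun i j => c * l i * l j * Real.cos (x i - x j))
      (of fun i j => c * l i * l j * Real.sin (x i - x j))
      (of fun i j => c * l i * l j * Real.sin (x i - x j))ᵀ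
      (of fun i j => c * l i * l j * Real.cos (x i - x j)) = (c • W) * Wᵀ := by
    ext (i | i) (j | j) <;>
    · simp [W, Matrix.mul_apply, Fin.sum_univ_two, Real.cos_sub, Real.sin_sub]
      ring
  have hgram : Wᵀ * (c • W) = diagonal fun _ => c * ∑ i, l i ^ 2 := by
    have hsq (i : ι) : l i * Real.cos (x i) * (c * (l i * Real.cos (x i))) +
        l i * Real.sin (x i) * (c * (l i * Real.sin (x i))) = c * l i ^ 2 := by
      linear_combination c * l i ^ 2 * Real.sin_sq_add_cos_sq (x i)
    ext a b
    fin_cases a <;> fin_cases b <;>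
      simp [W, Matrix.mul_apply, Finset.mul_sum, ← Finset.sum_add_distrib, ← hsq]
    · rw [add_neg_eq_zero]
      exact Finset.sum_congr rfl fun i _ => by ring
    · rw [add_neg_eq_zero]
      exact Finset.sum_congr rfl fun i _ => by ring
    · exact Finset.sum_congr rfl fun i _ => by ring
  have hcard : Fintype.card (Fin 2) ≤ Fintype.card (ι ⊕ ι) := by
    have := Fintype.card_pos (α := ι)
    simp only [Fintype.card_fin, Fintype.card_sum]
    omega
  rw [hfac, charpoly_mul_comm_of_le _ _ hcard, hgram, charpoly_diagonal]
  simp [two_mul]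

/-- If `l hᵀ + h lᵀ` has rank one, then `l` and `h` are nonzero and proportional. -/
theorem exists_eq_smul_of_rank_symmetrized_eq_one {ι : Type*} [Fintype ι] (l h : ι → ℝ)
    (hrank : (of fun i j => l i * h j + h i * l j : Matrix ι ι ℝ).rank = 1) :
    ∃ c : ℝ, c ≠ 0 ∧ l ≠ 0 ∧ h = c • l := by
  have hpar (i j : ι) : l i * h j = h i * l j := by
    have := Matrix.mul_apply_eq_of_rank_le_one _ hrank.le i j i j
    simp only [of_apply] at this
    have : (l i * h j - h i * l j) ^ 2 = 0 := by linear_combination -this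
    exact sub_eq_zero.mp (pow_eq_zero_iff two_ne_zero |>.mp this)
  have hl : l ≠ 0 := by
    rintro rfl
    have hz : (of fun i j => (0 : ι → ℝ) i * h j + h i * (0 : ι → ℝ) j) = 0 := by
      ext i j
      simp
    rw [hz, rank_zero] at hrank
    exact zero_ne_one hrank
  have hh : h ≠ 0 := by
    rintro rfl
    have hz : (of fun i j => l i * (0 : ι → ℝ) j + (0 : ι → ℝ) i * l j) = 0 := by
      ext i j
      simp
    rw [hz, rank_zero] at hrank
    exact zero_ne_one hrank
  obtain ⟨i, hi⟩ := Function.ne_iff.mp hl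
  have heq : h = (h i / l i) • l := by
    ext j
    have : l i ≠ 0 := hi
    simp only [Pi.smul_apply, smul_eq_mul]
    field_simp
    linear_combination hpar i j
  refine ⟨h i / l i, fun h0 => hh ?_, hl, heq⟩
  rw [heq, h0, zero_smul]

theorem Polynomial.card_filter_roots_X_pow_mul {K : Type*} [Field K] [DecidableEq K] {a : K}
    (ha : a ≠ 0) (m k : ℕ) :
    (((X ^ m * (X - C a) ^ k : K[X]).roots).filter (fun μ => μ ≠ 0)).card = k := by
  rw [roots_mul (mul_ne_zero (pow_ne_zero _ X_ne_zero) (pow_ne_zero _ (X_sub_C_ne_zero a))),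
    roots_X_pow, roots_pow, roots_X_sub_C, Multiset.filter_add, Multiset.nsmul_singleton,
    Multiset.nsmul_singleton, Multiset.filter_eq_nil.mpr, Multiset.filter_eq_self.mpr]
  · simp
  · intro b hb
    rwa [Multiset.eq_of_mem_replicate hb]
  · intro b hb
    simpa using Multiset.eq_of_mem_replicate hb

theorem rank_one_case
    (n : ℕ) (hn : 2 ≤ n) (x l h : Fin n → ℝ)
    (L : Matrix (Fin n) (Fin n) ℝ)
    (hL : L = Matrix.of fun i j => l i * h j + h i * l j)
    (A B : Matrix (Fin n) (Fin n) ℝ)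
    (hA : A = Matrix.of fun i j => L i j * Real.cos (x i - x j))
    (hB : B = Matrix.of fun i j => L i j * Real.sin (x i - x j))
    (P : Matrix (Fin n ⊕ Fin n) (Fin n ⊕ Fin n) ℝ)
    (hP : P = Matrix.fromBlocks A B Bᵀ A)
    (γ δ : ℝ) (hγ : γ = ∑ i, l i * h i)
    (hδ : δ = Real.sqrt (∑ i, (l i) ^ 2) * Real.sqrt (∑ i, (h i) ^ 2))
    (hrank : L.rank = 1) :
    δ = |γ| ∧ γ ≠ 0 ∧
    (γ = δ → P.charpoly = X ^ (2 * n - 2) * (X - C (2 * γ)) ^ 2) ∧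
    (γ = -δ → P.charpoly = X ^ (2 * n - 2) * (X + C (2 * δ)) ^ 2) ∧
    (P.charpoly.roots.filter (fun μ => μ ≠ 0)).card = 2 := by
  subst hL
  obtain ⟨c, hc, hl, rfl⟩ := exists_eq_smul_of_rank_symmetrized_eq_one l h hrank
  have : Nonempty (Fin n) := ⟨⟨0, by omega⟩⟩
  have hpos : 0 < ∑ i, l i ^ 2 := by
    obtain ⟨i, hi⟩ := Function.ne_iff.mp hl
    exact Finset.sum_pos' (fun i _ => sq_nonneg _) ⟨i, Finset.mem_univ i, sq_pos_of_ne_zero hi⟩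
  have hγ' : γ = c * ∑ i, l i ^ 2 := by
    rw [hγ, Finset.mul_sum]
    exact Finset.sum_congr rfl fun i _ => by simp only [Pi.smul_apply, smul_eq_mul]; ring
  have hδ' : δ = |γ| := by
    simp only [Pi.smul_apply, smul_eq_mul, mul_pow, ← Finset.mul_sum] at hδ
    rw [hδ, hγ', Real.sqrt_mul (sq_nonneg c), Real.sqrt_sq_eq_abs, abs_mul, abs_of_pos hpos]
    linear_combination |c| * Real.mul_self_sqrt hpos.le
  have hγ0 : γ ≠ 0 := hγ' ▸ mul_ne_zero hc hpos.ne'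
  have hchar : P.charpoly = X ^ (2 * n - 2) * (X - C (2 * γ)) ^ 2 := by
    have hA' : A = of fun i j => 2 * c * l i * l j * Real.cos (x i - x j) := by
      rw [hA]
      ext i j
      simp only [of_apply, Pi.smul_apply, smul_eq_mul]
      ring
    have hB' : B = of fun i j => 2 * c * l i * l j * Real.sin (x i - x j) := by
      rw [hB]
      ext i j
      simp only [of_apply, Pi.smul_apply, smul_eq_mul]
      ring
    rw [hP, hA', hB', charpoly_fromBlocks_mul_cos_sin, Fintype.card_fin, hγ', mul_assoc]
  refine ⟨hδ', hγ0, fun _ => hchar, fun hneg => ?_, ?_⟩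
  · rw [hchar, hneg, mul_neg, C_neg, sub_neg_eq_add]
  · rw [hchar]
    convert card_filter_roots_X_pow_mul (mul_ne_zero two_ne_zero hγ0) (2 * n - 2) 2
end
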